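/- arXiv:1412.3881 — 5 statements merged into one kernel-verified Lean document; each statement's English description precedes it below -/
import Mathlib

section
/- Let G be a finite simple graph on a vertex set V with a dominating induced matching, given by a matching M = {{x_{j1}, x_{j2}} : j = 1, …, m} of G such that W = V \ ∪_{j=1}^m {x_{j1}, x_{j2}} is an independent set of G. Let G̃ be the graph on the vertex set W ∪ {x_1, …, x_m} with edge set { {w, x_j} : w ∈ W, and {w, x_{j1}} ∈ E(G) or {w, x_{j2}} ∈ E(G) } (obtained from G by identifying x_{j1} and x_{j2} for each j). Then G is chordal if and only if G̃ is a forest. -/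
namespace DIM

open SimpleGraph

variable {V : Type*}

/-- `M` is a matching of `G`: a set of edges of `G` that are pairwise disjoint. -/
def IsMatching (G : SimpleGraph V) (M : Set (Sym2 V)) : Prop :=
  M ⊆ G.edgeSet ∧ ∀ e ∈ M, ∀ e' ∈ M, e ≠ e' → ∀ v : V, v ∈ e → v ∉ e'

/-- A maximal matching: a matching not properly contained in any other matching. -/
def IsMaximalMatching (G : SimpleGraph V) (M : Set (Sym2 V)) : Prop :=
  IsMatching G M ∧ ∀ M' : Set (Sym2 V), IsMatching G M' → M ⊆ M' → M' = M

/-- Two edges `e`, `e'` are 3-disjoint in `G`: they are disjoint and no edge `f` of `G`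
meets both. -/
def ThreeDisjoint (G : SimpleGraph V) (e e' : Sym2 V) : Prop :=
  (∀ v : V, v ∈ e → v ∉ e') ∧
    ∀ f ∈ G.edgeSet, ¬((∃ v, v ∈ f ∧ v ∈ e) ∧ (∃ v, v ∈ f ∧ v ∈ e'))

/-- An induced matching of `G`: a set of edges of `G` that are pairwise 3-disjoint. -/
def IsInducedMatching (G : SimpleGraph V) (M : Set (Sym2 V)) : Prop :=
  M ⊆ G.edgeSet ∧ ∀ e ∈ M, ∀ e' ∈ M, e ≠ e' → ThreeDisjoint G e e'

/-- `match(G)`: the maximum cardinality of a matching of `G`. -/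
noncomputable def matchNum (G : SimpleGraph V) : ℕ :=
  sSup {n | ∃ M : Set (Sym2 V), IsMatching G M ∧ M.ncard = n}

/-- `min-match(G)`: the minimum cardinality of a maximal matching of `G`. -/
noncomputable def minMatchNum (G : SimpleGraph V) : ℕ :=
  sInf {n | ∃ M : Set (Sym2 V), IsMaximalMatching G M ∧ M.ncard = n}

/-- `ind-match(G)`: the maximum cardinality of an induced matching of `G`. -/
noncomputable def indMatchNum (G : SimpleGraph V) : ℕ :=
  sSup {n | ∃ M : Set (Sym2 V), IsInducedMatching G M ∧ M.ncard = n}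

/-- A dominating induced matching: an induced matching that is also a maximal matching. -/
def IsDIM (G : SimpleGraph V) (M : Set (Sym2 V)) : Prop :=
  IsInducedMatching G M ∧ IsMaximalMatching G M

/-- `S` is an independent set of `G`. -/
def IsIndepSet (G : SimpleGraph V) (S : Set V) : Prop :=
  ∀ a ∈ S, ∀ b ∈ S, ¬G.Adj a b

/-- `C` is a vertex cover of `G`. -/
def IsVertexCover (G : SimpleGraph V) (C : Set V) : Prop :=
  ∀ ⦃u w : V⦄, G.Adj u w → u ∈ C ∨ w ∈ C

/-- `C` is a minimal vertex cover of `G`. -/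
def IsMinimalVertexCover (G : SimpleGraph V) (C : Set V) : Prop :=
  IsVertexCover G C ∧ ∀ C' ⊆ C, IsVertexCover G C' → C' = C

/-- `G` is unmixed: all minimal vertex covers of `G` have the same cardinality. -/
def Unmixed (G : SimpleGraph V) : Prop :=
  ∀ C C' : Set V, IsMinimalVertexCover G C → IsMinimalVertexCover G C' →
    C.ncard = C'.ncard

/-- The degree of a vertex, as the cardinality of its neighbourhood. -/
noncomputable def deg (G : SimpleGraph V) (v : V) : ℕ := (G.neighborSet v).ncard

/-- A decomposition `V = W ⊔ M` exhibiting a dominating induced matching of `G`: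
`W` is an independent set, the complement of `W` is the (injective) family of vertices
`x j k` (`j : Fin m`, `k : Fin 2`), each pair `{x j 0, x j 1}` is an edge of `G`, and the
induced subgraph on the complement of `W` consists exactly of these `m` disjoint edges. -/
def IsDimDecomp (G : SimpleGraph V) (W : Set V) {m : ℕ} (x : Fin m → Fin 2 → V) : Prop :=
  Function.Injective (fun p : Fin m × Fin 2 => x p.1 p.2) ∧
  (∀ v : V, v ∈ W ↔ ∀ j k, v ≠ x j k) ∧
  IsIndepSet G W ∧
  (∀ j, G.Adj (x j 0) (x j 1)) ∧
  (∀ j k j' k', G.Adj (x j k) (x j' k') → j = j')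

/-- The (open) neighbourhood `N_G(U)` of a set of vertices. -/
def nbd (G : SimpleGraph V) (U : Set V) : Set V := {v | ∃ u ∈ U, G.Adj u v}

/-- The closed neighbourhood `N_G[U]` of a set of vertices. -/
def cnbd (G : SimpleGraph V) (U : Set V) : Set V := U ∪ nbd G U

/-- `G` has a pendant triangle attached to `v`: a triangle through `v` whose other two
vertices have degree exactly `2` in `G`, while `deg v > 2`. -/
def HasPendantTriangle (G : SimpleGraph V) (v : V) : Prop :=
  ∃ t₁ t₂ : V, t₁ ≠ t₂ ∧ G.Adj v t₁ ∧ G.Adj v t₂ ∧ G.Adj t₁ t₂ ∧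
    deg G t₁ = 2 ∧ deg G t₂ = 2 ∧ 2 < deg G v

/-- `A` is a maximal independent set of the induced subgraph of `G` on `S`. -/
def IsMaxIndepOn (G : SimpleGraph V) (S A : Set V) : Prop :=
  A ⊆ S ∧ IsIndepSet G A ∧ ∀ B, A ⊆ B → B ⊆ S → IsIndepSet G B → B = A

/-- Vertex decomposability of the induced subgraph of `G` on the vertex set `S`:
either it is edgeless, or some vertex `v ∈ S` is a shedding vertex (no independent set
of `G_S \ N[v]` is a maximal independent set of `G_S \ v`) such that both
`G_S \ v` and `G_S \ N[v]` are vertex decomposable. -/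
inductive VDOn (G : SimpleGraph V) : Set V → Prop
  | edgeless (S : Set V) : (∀ u ∈ S, ∀ w ∈ S, ¬G.Adj u w) → VDOn G S
  | shed (S : Set V) (v : V) : v ∈ S →
      (∀ A : Set V, A ⊆ S \ {u | u = v ∨ G.Adj v u} → IsIndepSet G A →
        ¬IsMaxIndepOn G (S \ {v}) A) →
      VDOn G (S \ {v}) → VDOn G (S \ {u | u = v ∨ G.Adj v u}) → VDOn G S

/-- `G` is vertex decomposable. -/
def VertexDecomposable (G : SimpleGraph V) : Prop := VDOn G Set.univ

/-- `G` is chordal: every cycle of length greater than `3` has a chord, i.e. an edge of `G`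
joining two vertices of the cycle which is not an edge of the cycle. -/
def IsChordal (G : SimpleGraph V) : Prop :=
  ∀ (v : V) (c : G.Walk v v), c.IsCycle → 3 < c.length →
    ∃ u w : V, u ∈ c.support ∧ w ∈ c.support ∧ G.Adj u w ∧ s(u, w) ∉ c.edges

/-- `C` is a vertex cover of the induced subgraph of `G` on `S`. -/
def IsVertexCoverOn (G : SimpleGraph V) (S C : Set V) : Prop :=
  C ⊆ S ∧ ∀ ⦃u w : V⦄, G.Adj u w → u ∈ S → w ∈ S → u ∈ C ∨ w ∈ C

/-- `C` is a minimal vertex cover of the induced subgraph of `G` on `S`. -/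
def IsMinimalVertexCoverOn (G : SimpleGraph V) (S C : Set V) : Prop :=
  IsVertexCoverOn G S C ∧ ∀ C' ⊆ C, IsVertexCoverOn G S C' → C' = C

/-- `W₀`: the non-isolated vertices of `G` lying in `W`. -/
def W0 (G : SimpleGraph V) (W : Set V) : Set V := W ∩ {v | ∃ u, G.Adj v u}

/-- The set of indices `j` such that both endpoints of the matching edge
`{x j 0, x j 1}` have degree at least `2` in `G` (its cardinality is `m₂`). -/
def m2Set (G : SimpleGraph V) {m : ℕ} (x : Fin m → Fin 2 → V) : Set (Fin m) :=
  {j | 2 ≤ deg G (x j 0) ∧ 2 ≤ deg G (x j 1)}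

/-- The set of indices `j` such that the matching edge `{x j 0, x j 1}` survives in
`G' = G \ N_G[M₂]` with both endpoints of degree at least `2` in `G'`
(its cardinality is `m₂'`; it is empty when `G'` is edgeless). -/
def m2Set' (G : SimpleGraph V) {m : ℕ} (x : Fin m → Fin 2 → V) (M₂ : Set V) :
    Set (Fin m) :=
  {j | x j 0 ∉ cnbd G M₂ ∧ x j 1 ∉ cnbd G M₂ ∧
    2 ≤ (G.neighborSet (x j 0) \ cnbd G M₂).ncard ∧
    2 ≤ (G.neighborSet (x j 1) \ cnbd G M₂).ncard}

/-- `IN_G(U, W)`: the vertices of `W₀` that are isolated in `G \ N_G[U]`. -/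
def INSet (G : SimpleGraph V) (W U : Set V) : Set V :=
  {w | w ∈ W0 G W ∧ w ∉ cnbd G U ∧ ∀ u : V, G.Adj w u → u ∈ cnbd G U}


/-- The graph `G̃` obtained from `G` by identifying the two endpoints `x j 0`, `x j 1`
of each matching edge into a single vertex `j : Fin m`: its vertices are the elements of
`W` together with `Fin m`, and `w` is joined to `j` iff `w` is adjacent in `G` to
`x j 0` or to `x j 1`. -/
def tildeGraph {V : Type*} (G : SimpleGraph V) (W : Set V) {m : ℕ}
    (x : Fin m → Fin 2 → V) : SimpleGraph (↥W ⊕ Fin m) :=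
  SimpleGraph.fromRel (fun p q =>
    ∃ (w : ↥W) (j : Fin m), p = Sum.inl w ∧ q = Sum.inr j ∧
      (G.Adj (w : V) (x j 0) ∨ G.Adj (w : V) (x j 1)))

/-- A walk along which `P` holds can be transported along a vertex map `f` that sends every edge
between `P`-vertices to a pair joined by a walk along which `Q` holds. -/
theorem exists_walk_map {α β : Type*} {G : SimpleGraph α} {H : SimpleGraph β} {P : α → Prop}
    {Q : β → Prop} (f : α → β) (hPQ : ∀ a, P a → Q (f a))
    (hf : ∀ a b, G.Adj a b → P a → P b → ∃ q : H.Walk (f a) (f b), ∀ z ∈ q.support, Q z)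
    {u v : α} (p : G.Walk u v) (hp : ∀ z ∈ p.support, P z) :
    ∃ q : H.Walk (f u) (f v), ∀ z ∈ q.support, Q z := by
  induction p with
  | nil => exact ⟨.nil, by simpa using hPQ _ (hp _ (by simp))⟩
  | cons h p ih =>
    obtain ⟨q, hq⟩ := ih fun z hz => hp z (by simp [hz])
    obtain ⟨r, hr⟩ := hf _ _ h (hp _ (by simp)) (hp _ (by simp))
    refine ⟨r.append q, fun z hz => ?_⟩
    rcases (Walk.mem_support_append_iff _ _).1 hz with hz | hz
    exacts [hr z hz, hq z hz]

/-- A walk with vertices in `P` between distinct vertices of `N` can be replaced by an induced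
path with vertices in `P` that meets `N` in its two distinct endpoints only. -/
theorem exists_induced_path (G : SimpleGraph V) (N P : V → Prop) {u v : V} (p : G.Walk u v)
    (hP : ∀ z ∈ p.support, P z) (huv : u ≠ v) (hu : N u) (hv : N v) :
    ∃ (u v : V) (q : G.Walk u v), q.IsPath ∧ u ≠ v ∧ N u ∧ N v ∧ (∀ z ∈ q.support, P z) ∧
      (∀ z ∈ q.support, N z → z = u ∨ z = v) ∧
      ∀ a ∈ q.support, ∀ b ∈ q.support, G.Adj a b → s(a, b) ∈ q.edges := by
  classical
  induction hn : p.length using Nat.strong_induction_on generalizing u v p with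
  | _ n ih =>
  subst hn
  by_cases hpath : p.IsPath
  swap
  · refine ih _ ?_ p.bypass (fun z hz => hP z (p.support_bypass_subset_support hz)) huv hu hv rfl
    by_contra! hlt
    exact hpath (p.bypass_eq_self_of_length_le_length_bypass hlt ▸ p.bypass_isPath)
  by_cases hN : ∀ z ∈ p.support, N z → z = u ∨ z = v
  swap
  · push Not at hN
    obtain ⟨z, hz, hNz, hzu, hzv⟩ := hN
    exact ih _ (p.length_takeUntil_lt_length hz hzv) (p.takeUntil z hz)
      (fun y hy => hP y (p.support_takeUntil_subset_support hz hy)) hzu.symm hu hNz rfl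
  by_cases hI : ∀ a ∈ p.support, ∀ b ∈ p.support, G.Adj a b → s(a, b) ∈ p.edges
  · exact ⟨u, v, p, hpath, huv, hu, hv, hP, hN, hI⟩
  have key : ∃ i k, i < k ∧ k ≤ p.length ∧ G.Adj (p.getVert i) (p.getVert k) ∧
      s(p.getVert i, p.getVert k) ∉ p.edges := by
    push Not at hI
    obtain ⟨a, ha, b, hb, hab, he⟩ := hI
    obtain ⟨i, rfl, hi⟩ := Walk.mem_support_iff_exists_getVert.1 ha
    obtain ⟨k, rfl, hk⟩ := Walk.mem_support_iff_exists_getVert.1 hb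
    rcases lt_trichotomy i k with h | rfl | h
    · exact ⟨i, k, h, hk, hab, he⟩
    · exact (hab.ne rfl).elim
    · exact ⟨k, i, h, hi, hab.symm, by rwa [Sym2.eq_swap]⟩
  obtain ⟨i, k, hik, hk, hadj, he⟩ := key
  have hk' : k ≠ i + 1 := by
    rintro rfl
    exact he ((Walk.mk_mem_edges_iff_exists _).2 (by grind))
  refine ih _ ?_ ((p.take i).append (.cons hadj (p.drop k))) (fun z hz => hP z ?_) huv hu hv rfl
  · simp only [Walk.length_append, Walk.length_cons, Walk.take_length, Walk.drop_length]
    omega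
  · rw [Walk.mem_support_append_iff, Walk.support_cons, List.mem_cons] at hz
    rcases hz with hz | rfl | hz
    · exact (p.isSubwalk_take i).support_subset hz
    · exact p.getVert_mem_support i
    · exact (p.isSubwalk_drop k).support_subset hz

/-- Closing up an induced path with at least three vertices by a vertex adjacent to exactly its
two endpoints yields a chordless cycle. -/
theorem not_isChordal_of_induced_path {G : SimpleGraph V} {u v a : V} {q : G.Walk u v}
    (hq : q.IsPath) (hind : ∀ a ∈ q.support, ∀ b ∈ q.support, G.Adj a b → s(a, b) ∈ q.edges)
    (hlen : 2 ≤ q.length) (huv : u ≠ v) (ha : a ∉ q.support) (hau : G.Adj a u) (hva : G.Adj v a)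
    (honly : ∀ z ∈ q.support, G.Adj z a → z = u ∨ z = v) : ¬IsChordal G := by
  intro hG
  have hcyc : (Walk.cons hau (q.concat hva)).IsCycle := by
    rw [Walk.cons_isCycle_iff, Walk.concat_isPath_iff]
    refine ⟨⟨hq, ha⟩, ?_⟩
    rw [Walk.edges_concat, List.concat_eq_append, List.mem_append, List.mem_singleton]
    rintro (h | h)
    · exact ha (q.fst_mem_support_of_mem_edges h)
    · rcases Sym2.eq_iff.1 h with h | h
      exacts [hau.ne h.2.symm, huv h.2]
  obtain ⟨b, c, hb, hc, hbc, he⟩ := hG a _ hcyc (by simp; omega)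
  have hsup : ∀ z, z ∈ (Walk.cons hau (q.concat hva)).support → z ∈ q.support ∨ z = a := by
    intro z
    simp only [Walk.support_cons, Walk.support_concat, List.mem_cons,
      List.mem_append, List.not_mem_nil]
    tauto
  simp only [Walk.edges_cons, Walk.edges_concat, List.concat_eq_append, List.mem_cons,
    List.mem_append, List.not_mem_nil, or_false, not_or] at he
  rcases hsup b hb with hb' | rfl <;> rcases hsup c hc with hc' | rfl
  · exact he.2.1 (hind b hb' c hc' hbc)
  · rcases honly b hb' hbc with rfl | rfl
    exacts [he.1 Sym2.eq_swap, he.2.2 rfl]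
  · rcases honly c hc' hbc.symm with rfl | rfl
    exacts [he.1 rfl, he.2.2 Sym2.eq_swap]
  · exact hbc.ne rfl

theorem tildeGraph_adj_inl_inr {G : SimpleGraph V} {W : Set V} {m : ℕ} {x : Fin m → Fin 2 → V}
    {w : W} {j : Fin m} :
    (tildeGraph G W x).Adj (.inl w) (.inr j) ↔ ∃ k, G.Adj w (x j k) := by
  simp [tildeGraph, Fin.exists_fin_two]

theorem not_tildeGraph_adj_inl_inl {G : SimpleGraph V} {W : Set V} {m : ℕ}
    {x : Fin m → Fin 2 → V} {w w' : W} : ¬(tildeGraph G W x).Adj (.inl w) (.inl w') := by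
  simp [tildeGraph]

theorem not_tildeGraph_adj_inr_inr {G : SimpleGraph V} {W : Set V} {m : ℕ}
    {x : Fin m → Fin 2 → V} {j j' : Fin m} : ¬(tildeGraph G W x).Adj (.inr j) (.inr j') := by
  simp [tildeGraph]

namespace IsDimDecomp

variable {G : SimpleGraph V} {W : Set V} {m : ℕ} {x : Fin m → Fin 2 → V}

theorem index_eq (hdec : IsDimDecomp G W x) {j j' : Fin m} {k k' : Fin 2}
    (h : x j k = x j' k') : j = j' ∧ k = k' :=
  Prod.ext_iff.1 (hdec.1 (a₁ := (j, k)) (a₂ := (j', k')) h)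

theorem ne_of_mem (hdec : IsDimDecomp G W x) {w : V} (hw : w ∈ W) (j : Fin m) (k : Fin 2) :
    w ≠ x j k := (hdec.2.1 w).1 hw j k

theorem exists_index (hdec : IsDimDecomp G W x) {v : V} (hv : v ∉ W) : ∃ j k, v = x j k := by
  by_contra! h
  exact hv ((hdec.2.1 v).2 h)

theorem adj_of_ne (hdec : IsDimDecomp G W x) (j : Fin m) {k k' : Fin 2} (h : k ≠ k') :
    G.Adj (x j k) (x j k') := by
  have := hdec.2.2.2.1 j
  fin_cases k <;> fin_cases k' <;> first | exact this | exact this.symm | exact (h rfl).elim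

/-- Two distinct vertices of `W` adjacent to the same matching edge cannot be joined by a walk
avoiding this edge, if `G` is chordal. -/
theorem not_isChordal_of_walk (hdec : IsDimDecomp G W x) (j : Fin m) {u v : V} (p : G.Walk u v)
    (hp : ∀ z ∈ p.support, ∀ k, z ≠ x j k) (huv : u ≠ v) (hu : ∃ k, G.Adj u (x j k))
    (hv : ∃ k, G.Adj v (x j k)) : ¬IsChordal G := by
  obtain ⟨u, v, q, hq, huv, hu, hv, hP, hN, hI⟩ :=
    exists_induced_path G (fun z => ∃ k, G.Adj z (x j k)) (fun z => ∀ k, z ≠ x j k) p hp huv hu hv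
  have hmem : ∀ z, (∀ k, z ≠ x j k) → (∃ k, G.Adj z (x j k)) → z ∈ W := by
    rintro z hz ⟨k, hk⟩
    by_contra hzW
    obtain ⟨j', k', rfl⟩ := hdec.exists_index hzW
    obtain rfl := hdec.2.2.2.2 _ _ _ _ hk
    exact hz k' rfl
  have huW := hmem u (hP u (by simp)) hu
  have hvW := hmem v (hP v (by simp)) hv
  have hlen : 2 ≤ q.length := by
    by_contra! hlt
    have h0 : q.length ≠ 0 := fun h => huv (Walk.eq_of_length_eq_zero h)
    exact hdec.2.2.1 u huW v hvW (Walk.adj_of_length_eq_one (by omega : q.length = 1))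
  have hx : ∀ k, x j k ∉ q.support := fun k hk => hP _ hk k rfl
  by_cases hcom : ∃ k, G.Adj u (x j k) ∧ G.Adj v (x j k)
  · obtain ⟨k, huk, hvk⟩ := hcom
    exact not_isChordal_of_induced_path hq hI hlen huv (hx k) huk.symm hvk
      fun z hz hzk => hN z hz ⟨k, hzk⟩
  obtain ⟨k, huk⟩ := hu
  obtain ⟨l, hvl⟩ := hv
  have hul : ¬G.Adj u (x j l) := fun h => hcom ⟨l, h, hvl⟩
  have hvk : ¬G.Adj v (x j k) := fun h => hcom ⟨k, huk, h⟩
  have hkl : l ≠ k := by rintro rfl; exact hul huk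
  have hadj := hdec.adj_of_ne j hkl
  have hsup : ∀ z, z ∈ (q.concat hvl).support ↔ z ∈ q.support ∨ z = x j l := by
    simp [Walk.support_concat]
  refine not_isChordal_of_induced_path (q := q.concat hvl) (a := x j k)
    ((Walk.concat_isPath_iff _).2 ⟨hq, hx l⟩) ?_ (by simp; omega) ?_ ?_ huk.symm hadj ?_
  · intro a ha b hb hab
    rw [hsup] at ha hb
    rw [Walk.edges_concat, List.concat_eq_append, List.mem_append, List.mem_singleton]
    rcases ha with ha | rfl <;> rcases hb with hb | rfl
    · exact .inl (hI a ha b hb hab)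
    · rcases hN a ha ⟨l, hab⟩ with rfl | rfl
      exacts [(hul hab).elim, .inr rfl]
    · rcases hN b hb ⟨l, hab.symm⟩ with rfl | rfl
      exacts [(hul hab.symm).elim, .inr Sym2.eq_swap]
    · exact (hab.ne rfl).elim
  · exact hP u (by simp) l
  · rw [hsup]
    rintro (h | h)
    exacts [hx k h, hadj.ne h.symm]
  · intro z hz hzk
    rcases (hsup z).1 hz with hz | rfl
    · rcases hN z hz ⟨k, hzk⟩ with rfl | rfl
      exacts [.inl rfl, (hvk hzk).elim]
    · exact .inr rfl

theorem tilde_isAcyclic_of_isChordal (hdec : IsDimDecomp G W x) (hG : IsChordal G) :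
    (tildeGraph G W x).IsAcyclic := by
  classical
  have hbridge : ∀ (w : W) (j : Fin m), (tildeGraph G W x).Adj (.inl w) (.inr j) →
      (tildeGraph G W x).IsBridge s(.inr j, .inl w) := by
    intro w j hwj
    rw [isBridge_iff_forall_walk_mem_edges]
    intro p
    by_contra he
    have he' : s(Sum.inr j, Sum.inl w) ∉ p.bypass.edges :=
      fun h => he (p.edges_bypass_subset_edges h)
    have hpath := p.bypass_isPath
    generalize p.bypass = q at he' hpath
    cases q with
    | @cons _ b _ h r =>
    obtain w' | j' := b
    swap
    · exact not_tildeGraph_adj_inr_inr h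
    rw [Walk.cons_isPath_iff] at hpath
    have hne : (w' : V) ≠ w := by
      intro heq
      obtain rfl := Subtype.ext heq
      simp at he'
    let f : ↥W ⊕ Fin m → V := Sum.elim (↑) (x · 0)
    have hPQ : ∀ a : ↥W ⊕ Fin m, a ≠ .inr j → ∀ k, f a ≠ x j k := by
      rintro (a | i) ha k
      · exact hdec.ne_of_mem a.2 j k
      · intro h
        exact ha (congrArg _ (hdec.index_eq h).1)
    have hedge : ∀ (a : W) (i : Fin m), i ≠ j → (tildeGraph G W x).Adj (.inl a) (.inr i) →
        ∃ q : G.Walk a (x i 0), ∀ z ∈ q.support, ∀ k, z ≠ x j k := by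
      intro a i hij hai
      have hi : ∀ k k', x i k ≠ x j k' := fun k k' h => hij (hdec.index_eq h).1
      obtain ⟨k, hk⟩ := tildeGraph_adj_inl_inr.1 hai
      by_cases hk0 : k = 0
      · subst hk0
        exact ⟨.cons hk .nil, by simpa [-Fin.forall_fin_two] using ⟨hdec.ne_of_mem a.2 j, hi 0⟩⟩
      · exact ⟨.cons hk (.cons (hdec.adj_of_ne i hk0) .nil),
          by simpa [-Fin.forall_fin_two] using ⟨hdec.ne_of_mem a.2 j, hi k, hi 0⟩⟩
    obtain ⟨q, hq⟩ := exists_walk_map (H := G) (P := (· ≠ Sum.inr j))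
      (Q := fun z => ∀ k, z ≠ x j k) f hPQ (by
        rintro (a | i) (b | i') hab ha hb
        · exact (not_tildeGraph_adj_inl_inl hab).elim
        · exact hedge a i' (fun h => hb (congrArg _ h)) hab
        · obtain ⟨q, hq⟩ := hedge b i (fun h => ha (congrArg _ h)) hab.symm
          exact ⟨q.reverse, fun z hz => hq z (List.mem_reverse.1 (q.support_reverse ▸ hz))⟩
        · exact (not_tildeGraph_adj_inr_inr hab).elim) r
      (fun z hz h => hpath.2 (h ▸ hz))
    exact hdec.not_isChordal_of_walk j q hq hne (tildeGraph_adj_inl_inr.1 h.symm)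
      (tildeGraph_adj_inl_inr.1 hwj) hG
  rw [isAcyclic_iff_forall_adj_isBridge]
  rintro (w | j) (w' | j') h
  · exact (not_tildeGraph_adj_inl_inl h).elim
  · exact Sym2.eq_swap ▸ hbridge w j' h
  · exact hbridge w' j h.symm
  · exact (not_tildeGraph_adj_inr_inr h).elim

theorem exists_mem_support (hdec : IsDimDecomp G W x) {v : V} {c : G.Walk v v}
    (hc : c.IsCycle) : ∃ w ∈ c.support, w ∈ W := by
  by_contra! hW
  have hlen := hc.three_le_length
  have hcyc : ∀ i, c.getVert i ∉ W := fun i => hW _ (c.getVert_mem_support i)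
  obtain ⟨j₀, k₀, h0⟩ := hdec.exists_index (hcyc 0)
  obtain ⟨j₁, k₁, h1⟩ := hdec.exists_index (hcyc 1)
  obtain ⟨j₂, k₂, h2⟩ := hdec.exists_index (hcyc 2)
  have a01 := c.adj_getVert_succ (i := 0) (by omega)
  have a12 := c.adj_getVert_succ (i := 1) (by omega)
  have n02 := hc.getVert_sub_one_ne_getVert_add_one (i := 1) (by omega)
  simp only [zero_add, Nat.reduceAdd, Nat.sub_self] at a01 a12 n02
  rw [h0, h1] at a01
  rw [h1, h2] at a12
  rw [h0, h2] at n02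
  obtain rfl := hdec.2.2.2.2 _ _ _ _ a01
  obtain rfl := hdec.2.2.2.2 _ _ _ _ a12
  have h₁ : k₀ ≠ k₁ := fun h => a01.ne (by rw [h])
  have h₂ : k₁ ≠ k₂ := fun h => a12.ne (by rw [h])
  have h₃ : k₀ ≠ k₂ := fun h => n02 (by rw [h])
  omega

theorem isChordal_of_tilde_isAcyclic (hdec : IsDimDecomp G W x)
    (hT : (tildeGraph G W x).IsAcyclic) : IsChordal G := by
  classical
  intro v c hc hlen
  obtain ⟨w, hwc, hwW⟩ := hdec.exists_mem_support hc
  suffices h : ∀ c : G.Walk w w, c.IsCycle → 3 < c.length →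
      ∃ a b, a ∈ c.support ∧ b ∈ c.support ∧ G.Adj a b ∧ s(a, b) ∉ c.edges by
    obtain ⟨a, b, ha, hb, hab, he⟩ := h (c.rotate w hwc) (hc.rotate hwc) (by simpa using hlen)
    refine ⟨a, b, ?_, ?_, hab, fun h => he ((c.rotate_edges w hwc).mem_iff.2 h)⟩
    · simpa using ha
    · simpa using hb
  clear! c
  intro c hc hlen
  have hnil := hc.not_nil
  have h1 : c.getVert 1 ∉ W := fun h => hdec.2.2.1 w hwW _ h (c.adj_snd hnil)
  have h2 : c.getVert (c.length - 1) ∉ W :=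
    fun h => hdec.2.2.1 _ h w hwW (c.adj_penultimate hnil)
  obtain ⟨j, k, hjk⟩ := hdec.exists_index h1
  obtain ⟨j', k', hjk'⟩ := hdec.exists_index h2
  have hinj := hc.getVert_injOn
  have hne : c.getVert 1 ≠ c.getVert (c.length - 1) := fun h => by
    have := @hinj 1 ⟨le_rfl, by omega⟩ (c.length - 1) ⟨by omega, by omega⟩ h
    omega
  by_cases hjj : j = j'
  · subst hjj
    refine ⟨c.getVert 1, c.getVert (c.length - 1), c.getVert_mem_support _,
      c.getVert_mem_support _, ?_, fun he => ?_⟩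
    · rw [hjk, hjk'] at hne ⊢
      exact hdec.adj_of_ne j fun h => hne (by rw [h])
    · have h0 : c.getVert 0 = c.getVert c.length := by simp
      have inj : ∀ a b, 1 ≤ a → a ≤ c.length → 1 ≤ b → b ≤ c.length →
          c.getVert a = c.getVert b → a = b :=
        fun a b ha ha' hb hb' h => hinj ⟨ha, ha'⟩ ⟨hb, hb'⟩ h
      obtain ⟨i, hi⟩ := (Walk.mk_mem_edges_iff_exists _).1 he
      rcases Nat.eq_zero_or_pos i with rfl | hi0 <;> grind
  exfalso
  let f : V → ↥W ⊕ Fin m := fun z =>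
    if hz : z ∈ W then .inl ⟨z, hz⟩ else .inr (hdec.exists_index hz).choose
  have fW : ∀ z (hz : z ∈ W), f z = .inl ⟨z, hz⟩ := fun z hz => dif_pos hz
  have fx : ∀ j k, f (x j k) = .inr j := by
    intro j k
    have hn : x j k ∉ W := fun h => hdec.ne_of_mem h j k rfl
    have hs := (hdec.exists_index hn).choose_spec
    obtain ⟨k', hk'⟩ := hs
    simp only [f, dif_neg hn, ← (hdec.index_eq hk').1]
  have hPQ : ∀ a, a ≠ w → f a ≠ .inl ⟨w, hwW⟩ := by
    intro a ha
    by_cases haW : a ∈ W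
    · simpa [fW a haW] using ha
    · simp [f, haW]
  have hf : ∀ a b, G.Adj a b → a ≠ w → b ≠ w →
      ∃ q : (tildeGraph G W x).Walk (f a) (f b), ∀ z ∈ q.support, z ≠ .inl ⟨w, hwW⟩ := by
    intro a b hab ha hb
    have hstep : f a = f b ∨ (tildeGraph G W x).Adj (f a) (f b) := by
      by_cases haW : a ∈ W <;> by_cases hbW : b ∈ W
      · exact (hdec.2.2.1 a haW b hbW hab).elim
      · obtain ⟨i, l, rfl⟩ := hdec.exists_index hbW
        rw [fW a haW, fx]
        exact .inr (tildeGraph_adj_inl_inr.2 ⟨l, hab⟩)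
      · obtain ⟨i, l, rfl⟩ := hdec.exists_index haW
        rw [fW b hbW, fx]
        exact .inr (tildeGraph_adj_inl_inr.2 ⟨l, hab.symm⟩).symm
      · obtain ⟨i, l, rfl⟩ := hdec.exists_index haW
        obtain ⟨i', l', rfl⟩ := hdec.exists_index hbW
        exact .inl (by rw [fx, fx, hdec.2.2.2.2 _ _ _ _ hab])
    rcases hstep with h | h
    · rw [← h]
      exact ⟨.nil, by simpa using hPQ a ha⟩
    · exact ⟨.cons h .nil, by simpa using ⟨hPQ a ha, hPQ b hb⟩⟩
  let r := (c.drop 1).take (c.length - 2)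
  have hsupp : ∀ z ∈ r.support, z ≠ w := by
    intro z hz hzw
    obtain ⟨i, hi, hil⟩ := Walk.mem_support_iff_exists_getVert.1 hz
    simp only [r, Walk.take_getVert, Walk.drop_getVert, Walk.take_length, Walk.drop_length]
      at hi hil
    have := (hc.getVert_endpoint_iff (by omega)).1 (hi.trans hzw)
    omega
  obtain ⟨q, hq⟩ : ∃ q : (tildeGraph G W x).Walk (.inr j) (.inr j'),
      ∀ z ∈ q.support, z ≠ .inl ⟨w, hwW⟩ := by
    obtain ⟨q, hq⟩ := exists_walk_map f hPQ hf r hsupp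
    have hs : f (c.getVert 1) = .inr j := by rw [hjk, fx]
    have ht : f ((c.drop 1).getVert (c.length - 2)) = .inr j' := by
      rw [Walk.drop_getVert, show 1 + (c.length - 2) = c.length - 1 by omega, hjk', fx]
    exact ⟨q.copy hs ht, by simpa using hq⟩
  have hwj : (tildeGraph G W x).Adj (.inl ⟨w, hwW⟩) (.inr j) :=
    tildeGraph_adj_inl_inr.2 ⟨k, hjk ▸ c.adj_snd hnil⟩
  have hwj' : (tildeGraph G W x).Adj (.inl ⟨w, hwW⟩) (.inr j') :=
    tildeGraph_adj_inl_inr.2 ⟨k', hjk' ▸ (c.adj_penultimate hnil).symm⟩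
  have hb := isBridge_iff_forall_walk_mem_edges.1 (isAcyclic_iff_forall_adj_isBridge.1 hT hwj)
    (.cons hwj' q.reverse)
  rw [Walk.edges_cons, List.mem_cons] at hb
  rcases hb with hb | hb
  · simp [hjj] at hb
  · exact hq _ (by simpa using Walk.fst_mem_support_of_mem_edges _ hb) rfl

end IsDimDecomp

/-- for a graph `G` with a dominating induced matching given by a
decomposition `V = W ⊔ M`, `G` is chordal if and only if the identification graph `G̃`
is a forest. -/
theorem isChordal_iff_tilde_isAcyclic {V : Type*} [Fintype V] [DecidableEq V]
    (G : SimpleGraph V) (W : Set V) {m : ℕ} (x : Fin m → Fin 2 → V)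
    (hdec : IsDimDecomp G W x) :
    IsChordal G ↔ (tildeGraph G W x).IsAcyclic := by
  exact ⟨hdec.tilde_isAcyclic_of_isChordal, hdec.isChordal_of_tilde_isAcyclic⟩

end DIM
end

section
/- Let G be a finite simple graph on a vertex set V and suppose G has a pendant triangle attached to a vertex v ∈ V. Then v is a shedding vertex of G, i.e., no independent set of the induced subgraph G \ N_G[v] is a maximal independent set of the induced subgraph G \ v. -/
namespace DIM

open SimpleGraph

variable {V : Type*}

/-- A vertex of degree `2` has no neighbours besides two given distinct ones. -/
theorem eq_or_eq_of_adj_of_deg_eq_two {G : SimpleGraph V} {t a b c : V}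
    (ht : deg G t = 2) (hab : a ≠ b) (ha : G.Adj t a) (hb : G.Adj t b) (hc : G.Adj t c) :
    c = a ∨ c = b := by
  have hfin : (G.neighborSet t).Finite :=
    Set.finite_of_ncard_ne_zero (by rw [show (G.neighborSet t).ncard = 2 from ht]; decide)
  have hsub : ({a, b} : Set V) ⊆ G.neighborSet t := by
    rintro x (rfl | rfl)
    exacts [ha, hb]
  have heq : ({a, b} : Set V) = G.neighborSet t :=
    Set.eq_of_subset_of_ncard_le hsub
      (by rw [Set.ncard_pair hab]; exact le_of_eq ht) hfin
  have hmem : c ∈ ({a, b} : Set V) := heq ▸ hc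
  simpa using hmem

/-- a vertex `v` to which a pendant triangle is attached is a shedding
vertex of `G`: no independent set of `G \ N_G[v]` is a maximal independent set of
`G \ v`. -/
theorem shedding_of_hasPendantTriangle {V : Type*} [Fintype V] [DecidableEq V]
    (G : SimpleGraph V) (v : V) (h : HasPendantTriangle G v) :
    ∀ S : Set V, S ⊆ {u | u = v ∨ G.Adj v u}ᶜ → IsIndepSet G S →
      ¬IsMaxIndepOn G {v}ᶜ S := by
  intro S hS hind hmax
  obtain ⟨t₁, t₂, -, hv₁, hv₂, h₁₂, hd₁, -, -⟩ := h
  have hnot : ∀ a ∈ S, ¬G.Adj t₁ a := by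
    intro a ha hadj
    rcases eq_or_eq_of_adj_of_deg_eq_two hd₁ hv₂.ne hv₁.symm h₁₂ hadj with rfl | rfl
    · exact hS ha (Or.inl rfl)
    · exact hS ha (Or.inr hv₂)
  have hins : IsIndepSet G (insert t₁ S) := by
    rintro a (rfl | ha) b (rfl | hb)
    · exact G.irrefl
    · exact hnot b hb
    · exact fun hab => hnot a ha hab.symm
    · exact hind a ha b hb
  have heq := hmax.2.2 (insert t₁ S) (Set.subset_insert _ _)
    (Set.insert_subset hv₁.ne' hmax.1) hins
  have ht : t₁ ∈ S := heq ▸ Set.mem_insert t₁ S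
  exact hS ht (Or.inr hv₁)

end DIM
end

section
/- For every integer n ≥ 3, the fully whiskered complete graph W(K_n) — the graph on vertex set {x_1, …, x_n, y_1, …, y_n} whose edges are all pairs {x_i, x_j} with i ≠ j together with the edges {x_i, y_i} for i = 1, …, n — satisfies ind-match(W(K_n)) = 1, min-match(W(K_n)) = ⌈n/2⌉, and match(W(K_n)) = n. -/
namespace DIM

open SimpleGraph

variable {V : Type*}

/-- The fully whiskered complete graph `W(K_n)`: vertices `x_i = Sum.inl i` and whisker
vertices `y_i = Sum.inr i`, with all edges `{x_i, x_j}` (`i ≠ j`) together with the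
whisker edges `{x_i, y_i}`. -/
def whiskeredComplete (n : ℕ) : SimpleGraph (Fin n ⊕ Fin n) :=
  SimpleGraph.fromRel (fun p q =>
    (∃ i j : Fin n, i ≠ j ∧ p = Sum.inl i ∧ q = Sum.inl j) ∨
    (∃ i : Fin n, p = Sum.inl i ∧ q = Sum.inr i))

theorem whiskeredComplete_adj_inl_inl {n : ℕ} {i j : Fin n} :
    (whiskeredComplete n).Adj (Sum.inl i) (Sum.inl j) ↔ i ≠ j := by
  simp [whiskeredComplete]
  grind

theorem whiskeredComplete_adj_inl_inr {n : ℕ} (i : Fin n) :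
    (whiskeredComplete n).Adj (Sum.inl i) (Sum.inr i) := by
  simp [whiskeredComplete]

/-- Every edge of `W(K_n)` has an endpoint in the clique `K_n`. -/
theorem exists_inl_mem_of_mem_edgeSet {n : ℕ} {e : Sym2 (Fin n ⊕ Fin n)}
    (he : e ∈ (whiskeredComplete n).edgeSet) : ∃ i : Fin n, Sum.inl i ∈ e := by
  induction e with
  | h p q =>
    rcases p with i | i
    · exact ⟨i, Sym2.mem_mk_left _ _⟩
    · rcases q with j | j
      · exact ⟨j, Sym2.mem_mk_right _ _⟩
      · simp [whiskeredComplete] at he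

/-- A matching of `W(K_n)` has at most `n` edges. -/
theorem ncard_le_of_isMatching {n : ℕ} {M : Set (Sym2 (Fin n ⊕ Fin n))}
    (hM : IsMatching (whiskeredComplete n) M) : M.ncard ≤ n := by
  choose f hf using fun e : M => exists_inl_mem_of_mem_edgeSet (hM.1 e.2)
  have hinj : Function.Injective f := by
    intro e e' h
    by_contra hne
    exact hM.2 e e.2 e' e'.2 (fun h' => hne (Subtype.ext h')) _ (hf e) (h ▸ hf e')
  simpa using Nat.card_le_card_of_injective f hinj

/-- An induced matching of `W(K_n)` has at most one edge. -/
theorem ncard_le_one_of_isInducedMatching {n : ℕ} {M : Set (Sym2 (Fin n ⊕ Fin n))}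
    (hM : IsInducedMatching (whiskeredComplete n) M) : M.ncard ≤ 1 := by
  rw [Set.ncard_le_one]
  intro e he e' he'
  by_contra hne
  obtain ⟨i, hi⟩ := exists_inl_mem_of_mem_edgeSet (hM.1 he)
  obtain ⟨j, hj⟩ := exists_inl_mem_of_mem_edgeSet (hM.1 he')
  obtain ⟨hdisj, hfar⟩ := hM.2 e he e' he' hne
  have hij : i ≠ j := fun h => hdisj _ hi (h ▸ hj)
  exact hfar s(Sum.inl i, Sum.inl j) (whiskeredComplete_adj_inl_inl.2 hij)
    ⟨⟨_, Sym2.mem_mk_left _ _, hi⟩, ⟨_, Sym2.mem_mk_right _ _, hj⟩⟩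

/-- A maximal matching of `W(K_n)` covers the clique `K_n`. -/
theorem exists_mem_of_isMaximalMatching {n : ℕ} {M : Set (Sym2 (Fin n ⊕ Fin n))}
    (hM : IsMaximalMatching (whiskeredComplete n) M) (i : Fin n) :
    ∃ e ∈ M, Sum.inl i ∈ e := by
  by_contra! hi
  have hr : ∀ e ∈ M, Sum.inr i ∉ e := by
    intro e he hie
    obtain ⟨p, rfl⟩ := Sym2.mem_iff_exists.1 hie
    have hadj := hM.1.1 he
    have hp := hi _ he
    rcases p with j | j <;> simp [whiskeredComplete] at hadj hp
    exact hp hadj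
  have hwhisker : ∀ e ∈ M, ∀ v ∈ s(Sum.inl i, Sum.inr i), v ∉ e := by
    intro e he v hv
    rcases Sym2.mem_iff.1 hv with rfl | rfl
    exacts [hi e he, hr e he]
  have hins : IsMatching (whiskeredComplete n) (insert s(Sum.inl i, Sum.inr i) M) := by
    refine ⟨Set.insert_subset (whiskeredComplete_adj_inl_inr i) hM.1.1, ?_⟩
    rintro e (rfl | he) e' (rfl | he') hne v hv hv'
    · exact hne rfl
    · exact hwhisker e' he' v hv hv'
    · exact hwhisker e he v hv' hv
    · exact hM.1.2 e he e' he' hne v hv hv'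
  have hmem : s(Sum.inl i, Sum.inr i) ∈ M :=
    hM.2 _ hins (Set.subset_insert _ _) ▸ Set.mem_insert _ _
  exact hi _ hmem (Sym2.mem_mk_left _ _)

/-- A matching of `W(K_n)` covering the clique `K_n` is maximal. -/
theorem IsMatching.isMaximalMatching_of_cover {n : ℕ} {M : Set (Sym2 (Fin n ⊕ Fin n))}
    (hM : IsMatching (whiskeredComplete n) M) (hcov : ∀ i : Fin n, ∃ e ∈ M, Sum.inl i ∈ e) :
    IsMaximalMatching (whiskeredComplete n) M := by
  refine ⟨hM, fun M' hM' hsub => Set.Subset.antisymm (fun e he => ?_) hsub⟩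
  obtain ⟨i, hi⟩ := exists_inl_mem_of_mem_edgeSet (hM'.1 he)
  obtain ⟨e', he', hi'⟩ := hcov i
  by_contra hne
  exact hM'.2 e he e' (hsub he') (fun h => hne (h ▸ he')) _ hi hi'

/-- A maximal matching of `W(K_n)` has at least `n / 2` edges. -/
theorem le_two_mul_ncard_of_isMaximalMatching {n : ℕ} {M : Set (Sym2 (Fin n ⊕ Fin n))}
    (hM : IsMaximalMatching (whiskeredComplete n) M) : n ≤ 2 * M.ncard := by
  classical
  choose g hgM hg using exists_mem_of_isMaximalMatching hM
  have h := Finset.card_le_mul_card_image_of_maps_to (f := g) (s := Finset.univ)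
    (t := M.toFinite.toFinset) (by simpa using hgM) 2 (fun e _ => by
      have hsub : (Finset.univ.filter fun i => g i = e).map Function.Embedding.inl ⊆
          e.toFinset := by
        intro v hv
        simp only [Finset.mem_map, Finset.mem_filter, Finset.mem_univ, true_and] at hv
        obtain ⟨i, rfl, rfl⟩ := hv
        simpa using hg i
      have hcard := Finset.card_le_card hsub
      rw [Finset.card_map, Sym2.card_toFinset] at hcard
      split_ifs at hcard <;> omega)
  rwa [Finset.card_univ, Fintype.card_fin, ← Set.ncard_eq_toFinset_card] at h

/-- The range of a family of edges no two of which share a vertex is a matching of the same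
cardinality as the index type. -/
theorem isMatching_range {G : SimpleGraph V} {m : ℕ} {f : Fin m → Sym2 V}
    (hf : ∀ k, f k ∈ G.edgeSet) (hdisj : ∀ k l v, v ∈ f k → v ∈ f l → k = l) :
    IsMatching G (Set.range f) ∧ (Set.range f).ncard = m := by
  refine ⟨⟨Set.range_subset_iff.2 hf, ?_⟩, ?_⟩
  · rintro _ ⟨k, rfl⟩ _ ⟨l, rfl⟩ hne v hv hv'
    exact hne (congrArg f (hdisj k l v hv hv'))
  · have hinj : Function.Injective f := fun k l h =>
      hdisj k l _ (Sym2.out_fst_mem (f k)) (h ▸ Sym2.out_fst_mem (f k))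
    rw [← Nat.card_coe_set_eq, Nat.card_range_of_injective hinj, Nat.card_fin]

theorem exists_isMatching_ncard_eq (n : ℕ) :
    ∃ M, IsMatching (whiskeredComplete n) M ∧ M.ncard = n :=
  ⟨_, isMatching_range (f := fun i : Fin n => s(Sum.inl i, Sum.inr i))
    whiskeredComplete_adj_inl_inr (by
      intro k l v hk hl
      simp only [Sym2.mem_iff] at hk hl
      grind)⟩

/-- Pairing up consecutive clique vertices, with a whisker at the last one if `n` is odd, gives
a maximal matching of `W(K_n)` with `⌈n / 2⌉` edges. -/
theorem exists_isMaximalMatching_ncard_eq (n : ℕ) :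
    ∃ M, IsMaximalMatching (whiskeredComplete n) M ∧ M.ncard = (n + 1) / 2 := by
  let a (k : Fin ((n + 1) / 2)) : Fin n := ⟨2 * k, by omega⟩
  let b (k : Fin ((n + 1) / 2)) : Fin n ⊕ Fin n :=
    if h : 2 * k.1 + 1 < n then Sum.inl ⟨2 * k + 1, h⟩ else Sum.inr (a k)
  have hmem : ∀ k v, v ∈ s(Sum.inl (a k), b k) →
      Sum.elim (fun i => i.1 / 2) (fun i => i.1 / 2) v = k.1 := by
    intro k v hv
    rcases Sym2.mem_iff.1 hv with rfl | rfl
    · simp [a]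
    · simp only [b]
      split_ifs
      · simp only [Sum.elim_inl]
        omega
      · simp [a]
  obtain ⟨hM, hcard⟩ := isMatching_range (G := whiskeredComplete n)
    (f := fun k => s(Sum.inl (a k), b k)) (fun k => by
      simp only [b, SimpleGraph.mem_edgeSet]
      split_ifs
      · exact whiskeredComplete_adj_inl_inl.2 (by simp [a])
      · exact whiskeredComplete_adj_inl_inr _)
    (fun k l v hk hl => Fin.ext ((hmem k v hk).symm.trans (hmem l v hl)))
  refine ⟨_, hM.isMaximalMatching_of_cover (fun i => ?_), hcard⟩
  refine ⟨_, ⟨⟨i / 2, by omega⟩, rfl⟩, ?_⟩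
  rcases Nat.mod_two_eq_zero_or_one i with h | h
  · have hi : a ⟨i / 2, by omega⟩ = i := Fin.ext (by simp only [a]; omega)
    exact Sym2.mem_iff.2 (Or.inl (by rw [hi]))
  · have hi : 2 * (i.1 / 2) + 1 = i := by omega
    exact Sym2.mem_iff.2 (Or.inr (by simp [b, hi]))

/-- for `n ≥ 3`, `ind-match(W(K_n)) = 1`, `min-match(W(K_n)) = ⌈n/2⌉` and
`match(W(K_n)) = n`. -/
theorem whiskeredComplete_invariants (n : ℕ) (hn : 3 ≤ n) :
    indMatchNum (whiskeredComplete n) = 1 ∧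
    minMatchNum (whiskeredComplete n) = (n + 1) / 2 ∧
    matchNum (whiskeredComplete n) = n := by
  refine ⟨IsGreatest.csSup_eq ⟨?_, ?_⟩, IsLeast.csInf_eq ⟨?_, ?_⟩, IsGreatest.csSup_eq ⟨?_, ?_⟩⟩
  · let i : Fin n := ⟨0, by omega⟩
    refine ⟨{s(Sum.inl i, Sum.inr i)}, ⟨?_, ?_⟩, Set.ncard_singleton _⟩
    · exact Set.singleton_subset_iff.2 (whiskeredComplete_adj_inl_inr i)
    · rintro e rfl e' rfl hne
      exact absurd rfl hne
  · rintro _ ⟨M, hM, rfl⟩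
    exact ncard_le_one_of_isInducedMatching hM
  · exact exists_isMaximalMatching_ncard_eq n
  · rintro _ ⟨M, hM, rfl⟩
    have := le_two_mul_ncard_of_isMaximalMatching hM
    omega
  · exact exists_isMatching_ncard_eq n
  · rintro _ ⟨M, hM, rfl⟩
    exact ncard_le_of_isMatching hM

end DIM
end

section
/- Let G_0 be the graph on the vertex set {1, 2, 3, 4, 5, 6} with edge set {{1,2}, {2,3}, {3,4}, {4,5}, {3,6}}. Then G_0 has no dominating induced matching, yet ind-match(G_0) = min-match(G_0) = 2. -/
namespace DIM

open SimpleGraph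

variable {V : Type*}

/-- The graph `G₀` on six vertices `1, …, 6` (here `0, …, 5 : Fin 6`) with edge set
`{{1,2}, {2,3}, {3,4}, {4,5}, {3,6}}`. -/
def Gzero : SimpleGraph (Fin 6) :=
  SimpleGraph.fromEdgeSet
    {s((0 : Fin 6), (1 : Fin 6)), s((1 : Fin 6), (2 : Fin 6)),
     s((2 : Fin 6), (3 : Fin 6)), s((3 : Fin 6), (4 : Fin 6)),
     s((2 : Fin 6), (5 : Fin 6))}

theorem mem_edgeSet_Gzero {e : Sym2 (Fin 6)} :
    e ∈ Gzero.edgeSet ↔ e ∈ ({s(0, 1), s(1, 2), s(2, 3), s(3, 4), s(2, 5)} : Finset _) := by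
  have h : ∀ e ∈ ({s(0, 1), s(1, 2), s(2, 3), s(3, 4), s(2, 5)} : Finset (Sym2 (Fin 6))),
      ¬e.IsDiag := by decide
  rw [Gzero, edgeSet_fromEdgeSet]
  constructor
  · simpa using fun he _ => he
  · exact fun he => ⟨by simpa using he, h e he⟩

/-- The only 3-disjoint pair of edges of `G₀` consists of the two ends of its long path. -/
theorem threeDisjoint_Gzero_iff {e e' : Sym2 (Fin 6)} (he : e ∈ Gzero.edgeSet)
    (he' : e' ∈ Gzero.edgeSet) :
    ThreeDisjoint Gzero e e' ↔ e = s(0, 1) ∧ e' = s(3, 4) ∨ e = s(3, 4) ∧ e' = s(0, 1) := by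
  simp only [ThreeDisjoint, mem_edgeSet_Gzero] at *
  revert e e'
  decide

/-- Every edge meets some edge of a maximal matching. -/
theorem IsMaximalMatching.exists_mem_inter {G : SimpleGraph V} {M : Set (Sym2 V)}
    (h : IsMaximalMatching G M) {f : Sym2 V} (hf : f ∈ G.edgeSet) :
    ∃ e ∈ M, ∃ v, v ∈ e ∧ v ∈ f := by
  by_contra! hdisj
  have hins : IsMatching G (insert f M) := by
    refine ⟨Set.insert_subset hf h.1.1, ?_⟩
    rintro e (rfl | he) e' (rfl | he') hne v hv hv'
    · exact hne rfl
    · exact hdisj e' he' v hv' hv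
    · exact hdisj e he v hv hv'
    · exact h.1.2 e he e' he' hne v hv hv'
  have hfM : f ∈ M := h.2 _ hins (Set.subset_insert f M) ▸ Set.mem_insert f M
  exact hdisj f hfM _ f.out_fst_mem f.out_fst_mem

/-- A matching meeting every edge is maximal. -/
theorem IsMatching.isMaximalMatching {G : SimpleGraph V} {M : Set (Sym2 V)}
    (h : IsMatching G M) (hmeet : ∀ f ∈ G.edgeSet, ∃ e ∈ M, ∃ v, v ∈ e ∧ v ∈ f) :
    IsMaximalMatching G M := by
  refine ⟨h, fun M' hM' hsub => (hsub.antisymm fun f hf => ?_).symm⟩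
  obtain ⟨e, he, v, hve, hvf⟩ := hmeet f (hM'.1 hf)
  by_contra hfM
  exact hM'.2 e (hsub he) f hf (fun hef => hfM (hef ▸ he)) v hve hvf

/-- A maximal matching of `G₀` contains distinct edges meeting the two ends of the long path. -/
theorem IsMaximalMatching.exists_ne_of_Gzero {M : Set (Sym2 (Fin 6))}
    (h : IsMaximalMatching Gzero M) : ∃ e ∈ M, ∃ e' ∈ M, e ≠ e' := by
  obtain ⟨e, he, v, hve, hv⟩ := h.exists_mem_inter (f := s(0, 1)) (mem_edgeSet_Gzero.2 (by decide))
  obtain ⟨e', he', w, hwe, hw⟩ := h.exists_mem_inter (f := s(3, 4)) (mem_edgeSet_Gzero.2 (by decide))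
  refine ⟨e, he, e', he', ?_⟩
  rintro rfl
  have key : ∀ e ∈ ({s(0, 1), s(1, 2), s(2, 3), s(3, 4), s(2, 5)} : Finset (Sym2 (Fin 6))),
      ∀ v ∈ e, v ∈ s(0, 1) → ∀ w ∈ e, w ∉ s(3, 4) := by decide
  exact key e (mem_edgeSet_Gzero.1 (h.1.1 he)) v hve hv w hwe hw

/-- An induced matching of `G₀` with two distinct edges is `{s(0, 1), s(3, 4)}`. -/
theorem IsInducedMatching.eq_of_ne_of_Gzero {M : Set (Sym2 (Fin 6))}
    (h : IsInducedMatching Gzero M) {e e' : Sym2 (Fin 6)} (he : e ∈ M) (he' : e' ∈ M)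
    (hne : e ≠ e') : M = {s(0, 1), s(3, 4)} := by
  have key : ∀ {a b}, a ∈ M → b ∈ M → a ≠ b →
      a = s(0, 1) ∧ b = s(3, 4) ∨ a = s(3, 4) ∧ b = s(0, 1) := fun ha hb hab =>
    (threeDisjoint_Gzero_iff (h.1 ha) (h.1 hb)).1 (h.2 _ ha _ hb hab)
  ext f
  simp only [Set.mem_insert_iff, Set.mem_singleton_iff]
  by_cases hfe : f = e <;> grind

theorem isInducedMatching_Gzero : IsInducedMatching Gzero {s(0, 1), s(3, 4)} := by
  have hsub : ({s(0, 1), s(3, 4)} : Set (Sym2 (Fin 6))) ⊆ Gzero.edgeSet := by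
    rintro e (rfl | rfl) <;> exact mem_edgeSet_Gzero.2 (by decide)
  refine ⟨hsub, fun e he e' he' hne => (threeDisjoint_Gzero_iff (hsub he) (hsub he')).2 ?_⟩
  simp only [Set.mem_insert_iff, Set.mem_singleton_iff] at he he'
  grind

theorem isMaximalMatching_Gzero : IsMaximalMatching Gzero {s(1, 2), s(3, 4)} := by
  refine IsMatching.isMaximalMatching ⟨?_, ?_⟩ ?_
  · rintro e (rfl | rfl) <;> exact mem_edgeSet_Gzero.2 (by decide)
  · simp only [Set.mem_insert_iff, Set.mem_singleton_iff]
    decide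
  · simp only [mem_edgeSet_Gzero, Set.mem_insert_iff, Set.mem_singleton_iff]
    decide

/-- `G₀` has no dominating induced matching, yet
`ind-match(G₀) = min-match(G₀) = 2`. -/
theorem Gzero_no_DIM_and_invariants :
    (¬∃ M : Set (Sym2 (Fin 6)), IsDIM Gzero M) ∧
    indMatchNum Gzero = 2 ∧ minMatchNum Gzero = 2 := by
  refine ⟨?_, IsGreatest.csSup_eq ⟨⟨_, isInducedMatching_Gzero, ?_⟩, ?_⟩,
    IsLeast.csInf_eq ⟨⟨_, isMaximalMatching_Gzero, ?_⟩, ?_⟩⟩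
  · rintro ⟨M, hind, hmax⟩
    obtain ⟨e, he, e', he', hne⟩ := hmax.exists_ne_of_Gzero
    obtain rfl := hind.eq_of_ne_of_Gzero he he' hne
    obtain ⟨f, rfl | rfl, v, hv, hv'⟩ :=
      hmax.exists_mem_inter (f := s(2, 5)) (mem_edgeSet_Gzero.2 (by decide)) <;>
    · revert v
      decide
  · exact Set.ncard_pair (by decide)
  · rintro _ ⟨M, hM, rfl⟩
    by_contra! hcard
    obtain ⟨e, he, e', he', hne⟩ := Set.one_lt_ncard_iff_nontrivial.1 (show 1 < M.ncard by omega)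
    rw [hM.eq_of_ne_of_Gzero he he' hne, Set.ncard_pair (by decide)] at hcard
    exact lt_irrefl 2 hcard
  · exact Set.ncard_pair (by decide)
  · rintro _ ⟨M, hM, rfl⟩
    obtain ⟨e, he, e', he', hne⟩ := hM.exists_ne_of_Gzero
    exact Set.one_lt_ncard_iff_nontrivial.2 ⟨e, he, e', he', hne⟩

end DIM
end

section
/- Let G be a finite simple graph on a vertex set V with a dominating induced matching, with a decomposition V = W ⊔ M where W = {y_1, …, y_r} is an independent set and the induced subgraph G_M consists of m disjoint edges {x_{j1}, x_{j2}}, j = 1, …, m. Assume that for each j = 1, …, m one of the following holds: (i) deg_G(x_{j1}) = 1 or deg_G(x_{j2}) = 1; (ii) deg_G(x_{j1}) = deg_G(x_{j2}) = 2 and there is y ∈ W with x_{j1}, x_{j2} ∈ N_G(y); (iii) {deg_G(x_{j1}), deg_G(x_{j2})} = {3, 2} and there is y ∈ W with N_G(y) = {x_{j1}, x_{j2}}; (iv) deg_G(x_{j1}) = deg_G(x_{j2}) = 3 and there are three distinct vertices y', y'', y''' ∈ W with {x_{j1}, y'} ∈ E(G), {x_{j2}, y''} ∈ E(G), N_G(y''')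 = {x_{j1}, x_{j2}}, and G has a pendant triangle attached to y' or to y''. Then G is vertex decomposable. -/
namespace DIM

open SimpleGraph

variable {V : Type*}

/-- The hypothesis of Theorem `DIM-VD`: each matching edge `{x j 0, x j 1}` satisfies
one of the conditions (i)–(iv). -/
def DimVDCond {V : Type*} (G : SimpleGraph V) (W : Set V) {m : ℕ}
    (x : Fin m → Fin 2 → V) : Prop :=
  ∀ j : Fin m,
    -- (i)
    (deg G (x j 0) = 1 ∨ deg G (x j 1) = 1) ∨
    -- (ii)
    (deg G (x j 0) = 2 ∧ deg G (x j 1) = 2 ∧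
      ∃ y ∈ W, G.Adj y (x j 0) ∧ G.Adj y (x j 1)) ∨
    -- (iii)
    (((deg G (x j 0) = 3 ∧ deg G (x j 1) = 2) ∨
      (deg G (x j 0) = 2 ∧ deg G (x j 1) = 3)) ∧
      ∃ y ∈ W, G.neighborSet y = {x j 0, x j 1}) ∨
    -- (iv)
    (deg G (x j 0) = 3 ∧ deg G (x j 1) = 3 ∧
      ∃ y₁ y₂ y₃ : V, y₁ ∈ W ∧ y₂ ∈ W ∧ y₃ ∈ W ∧
        y₁ ≠ y₂ ∧ y₁ ≠ y₃ ∧ y₂ ≠ y₃ ∧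
        G.Adj (x j 0) y₁ ∧ G.Adj (x j 1) y₂ ∧
        G.neighborSet y₃ = {x j 0, x j 1} ∧
        (HasPendantTriangle G y₁ ∨ HasPendantTriangle G y₂))

/-- A vertex `v` whose closed neighbourhood contains that of another vertex `u` is a shedding
vertex, so vertex decomposability follows from that of the deletion and of the link. -/
theorem VDOn.of_dominated {V : Type*} {G : SimpleGraph V} {S : Set V} {v u : V}
    (hv : v ∈ S) (hu : u ∈ S) (hvu : G.Adj v u)
    (hdom : ∀ w ∈ S, G.Adj u w → w = v ∨ G.Adj v w)
    (hdel : VDOn G (S \ {v})) (hlink : VDOn G (S \ {w | w = v ∨ G.Adj v w})) :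
    VDOn G S := by
  refine VDOn.shed S v hv ?_ hdel hlink
  rintro A hA hind ⟨hAS, -, hmax⟩
  have huv : ∀ a ∈ A, ¬ G.Adj u a := fun a ha h => (hA ha).2 (hdom a (hA ha).1 h)
  have hins : insert u A = A := by
    refine hmax _ (Set.subset_insert _ _) (Set.insert_subset ⟨hu, hvu.ne'⟩ hAS) ?_
    rintro a (rfl | ha) b (rfl | hb) hab
    · exact G.irrefl hab
    · exact huv b hb hab
    · exact huv a ha hab.symm
    · exact hind a ha b hb hab
  exact (hA (hins ▸ Set.mem_insert u A)).2 (Or.inr hvu)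

/-- `S` is the disjoint union of an independent set `U` and of the matching edges indexed by `T`,
and each of these edges either has an endpoint without neighbours in `U`, or spans a triangle with
a vertex of `U` that has no further neighbours, or has at most one vertex of `U` adjacent to it. -/
structure IsDimPart {V : Type*} (G : SimpleGraph V) {m : ℕ} (x : Fin m → Fin 2 → V)
    (S : Set V) (T : Set (Fin m)) (U : Set V) : Prop where
  mem_iff : ∀ v, v ∈ S ↔ v ∈ U ∨ ∃ j ∈ T, ∃ k, v = x j k
  notMem : ∀ j ∈ T, ∀ k, x j k ∉ U
  indep : IsIndepSet G U
  cond : ∀ j ∈ T,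
    (∃ k, ∀ u ∈ U, ¬ G.Adj u (x j k)) ∨
    (∃ y ∈ U, G.Adj y (x j 0) ∧ G.Adj y (x j 1) ∧ ∀ v, G.Adj y v → v = x j 0 ∨ v = x j 1) ∨
    (∃ y, ∀ k, ∀ u ∈ U, G.Adj u (x j k) → u = y)

section

variable {G : SimpleGraph V} {m : ℕ} {x : Fin m → Fin 2 → V} {S : Set V}
  {T : Set (Fin m)} {U : Set V}

/-- Deleting the closed neighbourhood of an endpoint of a matching edge. -/
theorem IsDimPart.link (hM : ∀ j k j' k', G.Adj (x j k) (x j' k') → j = j')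
    (hinj : ∀ j k j' k', x j k = x j' k' → j = j' ∧ k = k')
    (hedge : ∀ j k k', k ≠ k' → G.Adj (x j k) (x j k'))
    (h : IsDimPart G x S T U) {j : Fin m} (hj : j ∈ T) (k : Fin 2) :
    IsDimPart G x (S \ {w | w = x j k ∨ G.Adj (x j k) w}) (T \ {j})
      (U \ {w | G.Adj (x j k) w}) where
  mem_iff v := by
    have hn := h.notMem j hj k
    constructor
    · rintro ⟨hvS, hv⟩
      simp only [Set.mem_ofPred_eq, not_or] at hv
      rcases (h.mem_iff v).1 hvS with hvU | ⟨i, hi, l, rfl⟩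
      · exact Or.inl ⟨hvU, hv.2⟩
      · refine Or.inr ⟨i, ⟨hi, ?_⟩, l, rfl⟩
        rintro rfl
        exact hv.2 (hedge _ _ _ fun e => hv.1 (by rw [e]))
    · rintro (⟨hvU, hv⟩ | ⟨i, ⟨hi, hij⟩, l, rfl⟩)
      · refine ⟨(h.mem_iff v).2 (Or.inl hvU), ?_⟩
        rintro (rfl | hv')
        exacts [hn hvU, hv hv']
      · refine ⟨(h.mem_iff _).2 (Or.inr ⟨i, hi, l, rfl⟩), ?_⟩
        rintro (e | e)
        exacts [hij (hinj _ _ _ _ e).1, hij (hM _ _ _ _ e).symm]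
  notMem i hi l hl := h.notMem i hi.1 l hl.1
  indep a ha b hb := h.indep a ha.1 b hb.1
  cond i hi := by
    rcases h.cond i hi.1 with ⟨l, hl⟩ | ⟨y, hy, h0, h1, hy'⟩ | ⟨y, hy⟩
    · exact Or.inl ⟨l, fun u hu => hl u hu.1⟩
    · refine Or.inr (Or.inl ⟨y, ⟨hy, fun e => ?_⟩, h0, h1, hy'⟩)
      rcases hy' _ e.symm with e | e <;> exact hi.2 (hinj _ _ _ _ e).1.symm
    · exact Or.inr (Or.inr ⟨y, fun l u hu => hy l u hu.1⟩)

/-- Deleting an endpoint of a matching edge whose other endpoint has no neighbours in `U`. -/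
theorem IsDimPart.delete_endpoint (hM : ∀ j k j' k', G.Adj (x j k) (x j' k') → j = j')
    (hinj : ∀ j k j' k', x j k = x j' k' → j = j' ∧ k = k')
    (h : IsDimPart G x S T U) {j : Fin m} (hj : j ∈ T) {k k' : Fin 2} (hkk : k ≠ k')
    (hk : ∀ u ∈ U, ¬ G.Adj u (x j k)) :
    IsDimPart G x (S \ {x j k'}) (T \ {j}) (insert (x j k) U) where
  mem_iff v := by
    constructor
    · rintro ⟨hvS, hv⟩
      rcases (h.mem_iff v).1 hvS with hvU | ⟨i, hi, l, rfl⟩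
      · exact Or.inl (Or.inr hvU)
      · by_cases hij : i = j
        · subst hij
          have : l = k := by
            have : l ≠ k' := fun e => hv (by rw [e]; rfl)
            omega
          exact Or.inl (Or.inl (by rw [this]))
        · exact Or.inr ⟨i, ⟨hi, hij⟩, l, rfl⟩
    · rintro ((rfl | hvU) | ⟨i, ⟨hi, hij⟩, l, rfl⟩)
      · exact ⟨(h.mem_iff _).2 (Or.inr ⟨j, hj, k, rfl⟩), fun e => hkk (hinj _ _ _ _ e).2⟩
      · refine ⟨(h.mem_iff v).2 (Or.inl hvU), ?_⟩
        rintro rfl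
        exact h.notMem j hj k' hvU
      · exact ⟨(h.mem_iff _).2 (Or.inr ⟨i, hi, l, rfl⟩), fun e => hij (hinj _ _ _ _ e).1⟩
  notMem i hi l := by
    rintro (e | e)
    exacts [hi.2 (hinj _ _ _ _ e).1, h.notMem i hi.1 l e]
  indep := by
    rintro a (rfl | ha) b (rfl | hb) hab
    · exact G.irrefl hab
    · exact hk b hb hab.symm
    · exact hk a ha hab
    · exact h.indep a ha b hb hab
  cond i hi := by
    rcases h.cond i hi.1 with ⟨l, hl⟩ | ⟨y, hy, hy'⟩ | ⟨y, hy⟩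
    · refine Or.inl ⟨l, ?_⟩
      rintro u (rfl | hu) e
      exacts [hi.2 (hM _ _ _ _ e).symm, hl u hu e]
    · exact Or.inr (Or.inl ⟨y, Or.inr hy, hy'⟩)
    · refine Or.inr (Or.inr ⟨y, ?_⟩)
      rintro l u (rfl | hu) e
      exacts [absurd (hM _ _ _ _ e).symm hi.2, hy l u hu e]

/-- Deleting both endpoints of a matching edge. -/
theorem IsDimPart.delete_edge (hinj : ∀ j k j' k', x j k = x j' k' → j = j' ∧ k = k')
    (h : IsDimPart G x S T U) {j : Fin m} (hj : j ∈ T) :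
    IsDimPart G x ((S \ {x j 0}) \ {x j 1}) (T \ {j}) U where
  mem_iff v := by
    constructor
    · rintro ⟨⟨hvS, hv0⟩, hv1⟩
      rcases (h.mem_iff v).1 hvS with hvU | ⟨i, hi, l, rfl⟩
      · exact Or.inl hvU
      · refine Or.inr ⟨i, ⟨hi, ?_⟩, l, rfl⟩
        rintro rfl
        fin_cases l
        exacts [hv0 rfl, hv1 rfl]
    · rintro (hvU | ⟨i, ⟨hi, hij⟩, l, rfl⟩)
      · refine ⟨⟨(h.mem_iff v).2 (Or.inl hvU), ?_⟩, ?_⟩ <;> rintro rfl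
        exacts [h.notMem j hj 0 hvU, h.notMem j hj 1 hvU]
      · exact ⟨⟨(h.mem_iff _).2 (Or.inr ⟨i, hi, l, rfl⟩), fun e => hij (hinj _ _ _ _ e).1⟩,
          fun e => hij (hinj _ _ _ _ e).1⟩
  notMem i hi := h.notMem i hi.1
  indep := h.indep
  cond i hi := h.cond i hi.1

/-- Induced subgraphs covered by an `IsDimPart` decomposition are vertex decomposable. -/
theorem IsDimPart.vdOn [Finite V] (hM : ∀ j k j' k', G.Adj (x j k) (x j' k') → j = j')
    (hinj : ∀ j k j' k', x j k = x j' k' → j = j' ∧ k = k')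
    (hedge : ∀ j k k', k ≠ k' → G.Adj (x j k) (x j k'))
    (h : IsDimPart G x S T U) : VDOn G S := by
  induction S using WellFoundedLT.induction generalizing T U with
  | ind S ih =>
  have hUS : ∀ {v}, v ∈ U → v ∈ S := fun hv => (h.mem_iff _).2 (Or.inl hv)
  have hxS : ∀ {j}, j ∈ T → ∀ k, x j k ∈ S :=
    fun hj k => (h.mem_iff _).2 (Or.inr ⟨_, hj, k, rfl⟩)
  have lt_of : ∀ {v : V} {R : Set V}, v ∈ S → v ∈ R → S \ R < S := fun hv hR =>
    Set.ssubset_iff_subset_ne.2 ⟨Set.sdiff_subset, fun e => (e.symm ▸ hv : _ ∈ S \ _).2 hR⟩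
  by_cases ha : ∃ j ∈ T, ∃ k, ∀ u ∈ U, ¬ G.Adj u (x j k)
  · obtain ⟨j, hj, k, hk⟩ := ha
    obtain ⟨k', hkk⟩ := exists_ne k
    refine VDOn.of_dominated (hxS hj k') (hxS hj k) (hedge j _ _ hkk) ?_
      (ih _ (lt_of (hxS hj k') rfl) (h.delete_endpoint hM hinj hj hkk.symm hk))
      (ih _ (lt_of (hxS hj k') (Or.inl rfl)) (h.link hM hinj hedge hj k'))
    intro w hw hkw
    rcases (h.mem_iff w).1 hw with hwU | ⟨i, hi, l, rfl⟩
    · exact absurd hkw.symm (hk w hwU)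
    · obtain rfl := hM _ _ _ _ hkw
      have : l ≠ k := by rintro rfl; exact G.irrefl hkw
      have : l = k' := by omega
      exact Or.inl (by rw [this])
  by_cases hb : ∃ j ∈ T, ∃ y ∈ U, G.Adj y (x j 0) ∧ G.Adj y (x j 1) ∧
      ∀ v, G.Adj y v → v = x j 0 ∨ v = x j 1
  · obtain ⟨j, hj, y, hy, h0, h1, hy'⟩ := hb
    have h01 := hedge j 0 1 (by decide)
    refine VDOn.of_dominated (hxS hj 0) (hUS hy) h0.symm ?_ ?_
      (ih _ (lt_of (hxS hj 0) (Or.inl rfl)) (h.link hM hinj hedge hj 0))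
    · intro w _ hw
      rcases hy' w hw with rfl | rfl
      exacts [Or.inl rfl, Or.inr h01]
    · refine VDOn.of_dominated (v := x j 1) (u := y) ⟨hxS hj 1, h01.ne'⟩ ⟨hUS hy, h0.ne⟩ h1.symm
        ?_ ?_ ?_
      · rintro w ⟨-, hw0⟩ hw
        rcases hy' w hw with rfl | rfl
        exacts [absurd rfl hw0, Or.inl rfl]
      · exact ih _ (Set.sdiff_subset.trans_lt (lt_of (hxS hj 0) rfl)) (h.delete_edge hinj hj)
      · have e : (S \ {x j 0}) \ {w | w = x j 1 ∨ G.Adj (x j 1) w} =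
            S \ {w | w = x j 1 ∨ G.Adj (x j 1) w} := by
          rw [Set.sdiff_sdiff, Set.union_eq_right.2]
          rintro w rfl
          exact Or.inr h01.symm
        rw [e]
        exact ih _ (lt_of (hxS hj 1) (Or.inl rfl)) (h.link hM hinj hedge hj 1)
  have hc : ∀ j ∈ T, ∃ y, ∀ k, ∀ u ∈ U, G.Adj u (x j k) → u = y := fun j hj =>
    ((h.cond j hj).resolve_left fun h' => ha ⟨j, hj, h'⟩).resolve_left fun h' => hb ⟨j, hj, h'⟩
  push Not at ha
  have hboth : ∀ j ∈ T, ∀ y ∈ U, ∀ k k', G.Adj y (x j k) → G.Adj y (x j k') := by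
    intro j hj y hy k k' hk
    obtain ⟨z, hz⟩ := hc j hj
    obtain ⟨u, hu, hadj⟩ := ha j hj k'
    rwa [hz k y hy hk, ← hz k' u hu hadj]
  rcases T.eq_empty_or_nonempty with rfl | ⟨j, hj⟩
  · refine VDOn.edgeless S fun u hu w hw => h.indep u ?_ w ?_
    · simpa using (h.mem_iff u).1 hu
    · simpa using (h.mem_iff w).1 hw
  obtain ⟨y, hy, hy0⟩ := ha j hj 0
  have hyx : ∀ i ∈ T, ∀ k, x i k ≠ y := fun i hi k e => h.notMem i hi k (e ▸ hy)
  refine VDOn.of_dominated (hUS hy) (hxS hj 0) hy0 ?_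
    (ih _ (lt_of (hUS hy) rfl) (T := T) (U := U \ {y}) ?_)
    (ih _ (lt_of (hUS hy) (Or.inl rfl)) (T := {i ∈ T | ¬ G.Adj y (x i 0)}) (U := U \ {y}) ?_)
  · intro w hw hadj
    rcases (h.mem_iff w).1 hw with hwU | ⟨i, hi, l, rfl⟩
    · obtain ⟨z, hz⟩ := hc j hj
      exact Or.inl ((hz 0 w hwU hadj.symm).trans (hz 0 y hy hy0).symm)
    · obtain rfl := hM _ _ _ _ hadj
      exact Or.inr (hboth j hj y hy 0 l hy0)
  · refine ⟨fun v => ?_, fun i hi k hk => h.notMem i hi k hk.1,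
      fun a ha b hb => h.indep a ha.1 b hb.1, fun i hi => Or.inr (Or.inr ?_)⟩
    · constructor
      · rintro ⟨hvS, hv⟩
        exact ((h.mem_iff v).1 hvS).imp_left fun hvU => ⟨hvU, hv⟩
      · rintro (⟨hvU, hv⟩ | ⟨i, hi, l, rfl⟩)
        exacts [⟨hUS hvU, hv⟩, ⟨hxS hi l, hyx i hi l⟩]
    · obtain ⟨z, hz⟩ := hc i hi
      exact ⟨z, fun k u hu => hz k u hu.1⟩
  · refine ⟨fun v => ?_, fun i hi k hk => h.notMem i hi.1 k hk.1,
      fun a ha b hb => h.indep a ha.1 b hb.1, fun i hi => Or.inr (Or.inr ?_)⟩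
    · constructor
      · rintro ⟨hvS, hv⟩
        simp only [Set.mem_ofPred_eq, not_or] at hv
        rcases (h.mem_iff v).1 hvS with hvU | ⟨i, hi, l, rfl⟩
        · exact Or.inl ⟨hvU, hv.1⟩
        · exact Or.inr ⟨i, ⟨hi, fun e => hv.2 (hboth i hi y hy 0 l e)⟩, l, rfl⟩
      · rintro (⟨hvU, hv⟩ | ⟨i, ⟨hi, hyi⟩, l, rfl⟩)
        · refine ⟨hUS hvU, ?_⟩
          rintro (e | e)
          exacts [hv e, h.indep y hy v hvU e]
        · refine ⟨hxS hi l, ?_⟩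
          rintro (e | e)
          exacts [hyx i hi l e, hyi (hboth i hi y hy l 0 e)]
    · obtain ⟨z, hz⟩ := hc i hi.1
      exact ⟨z, fun k u hu => hz k u hu.1⟩

end

/-- Two distinct neighbours of a vertex of degree `2` are all of its neighbours. -/
theorem eq_or_eq_of_deg_eq_two {V : Type*} {G : SimpleGraph V} {v a b w : V}
    (hdeg : deg G v = 2) (ha : G.Adj v a) (hb : G.Adj v b) (hab : a ≠ b) (hw : G.Adj v w) :
    w = a ∨ w = b := by
  obtain ⟨c, d, -, hcd⟩ := Set.ncard_eq_two.1 hdeg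
  have key : ∀ z, G.Adj v z ↔ z = c ∨ z = d := fun z => by
    rw [← mem_neighborSet, hcd]; rfl
  grind

/-- a graph `G` with a dominating induced matching whose decomposition
`V = W ⊔ M` satisfies conditions (i)–(iv) is vertex decomposable. -/
theorem vertexDecomposable_of_dimVDCond {V : Type*} [Fintype V] [DecidableEq V]
    (G : SimpleGraph V) (W : Set V) {m : ℕ} (x : Fin m → Fin 2 → V)
    (hdec : IsDimDecomp G W x) (hcond : DimVDCond G W x) :
    VertexDecomposable G := by
  obtain ⟨hinj, hW, hind, hadj, hM⟩ := hdec
  have hnot : ∀ j k, x j k ∉ W := fun j k hk => (hW _).1 hk j k rfl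
  refine IsDimPart.vdOn (x := x) (T := Set.univ) (U := W) hM ?_ ?_ ?_
  · intro j k j' k' e
    simpa using @hinj (j, k) (j', k') e
  · intro j k k' hkk
    fin_cases k <;> fin_cases k'
    exacts [absurd rfl hkk, hadj j, (hadj j).symm, absurd rfl hkk]
  have leaf : ∀ j k k', G.Adj (x j k) (x j k') → deg G (x j k) = 1 →
      ∀ u ∈ W, ¬ G.Adj u (x j k) := by
    intro j k k' hkk hdeg u hu huk
    obtain ⟨a, ha⟩ := Set.ncard_eq_one.1 hdeg
    have hu' : u ∈ G.neighborSet (x j k) := huk.symm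
    have hk' : x j k' ∈ G.neighborSet (x j k) := hkk
    rw [ha] at hu' hk'
    exact hnot j k' ((hu'.trans hk'.symm : u = x j k') ▸ hu)
  have tri : ∀ j, ∀ y ∈ W, G.neighborSet y = {x j 0, x j 1} →
      ∃ y ∈ W, G.Adj y (x j 0) ∧ G.Adj y (x j 1) ∧ ∀ v, G.Adj y v → v = x j 0 ∨ v = x j 1 := by
    intro j y hy e
    have key : ∀ z, G.Adj y z ↔ z = x j 0 ∨ z = x j 1 := fun z => by
      rw [← mem_neighborSet, e]; rfl
    exact ⟨y, hy, (key _).2 (Or.inl rfl), (key _).2 (Or.inr rfl), fun v => (key v).1⟩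
  refine ⟨fun v => ?_, fun j _ k => hnot j k, hind, fun j _ => ?_⟩
  · simp only [Set.mem_univ, true_and, true_iff, hW]
    by_contra! h
    obtain ⟨⟨j, k, e⟩, h'⟩ := h
    exact h' j k e
  · rcases hcond j with (h | h) | ⟨h0, h1, y, hy, hy0, hy1⟩ | ⟨-, y, hy, e⟩ |
      ⟨-, -, -, -, y, -, -, hy, -, -, -, -, -, e, -⟩
    · exact Or.inl ⟨0, leaf j 0 1 (hadj j) h⟩
    · exact Or.inl ⟨1, leaf j 1 0 (hadj j).symm h⟩
    · refine Or.inr (Or.inr ⟨y, fun k u hu huk => ?_⟩)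
      have hne : ∀ l, x j l ≠ u := fun l e => hnot j l (e ▸ hu)
      have hney : ∀ l, x j l ≠ y := fun l e => hnot j l (e ▸ hy)
      fin_cases k
      · exact (eq_or_eq_of_deg_eq_two h0 hy0.symm (hadj j) (hney 1).symm huk.symm).resolve_right
          (hne 1).symm
      · exact (eq_or_eq_of_deg_eq_two h1 hy1.symm (hadj j).symm (hney 0).symm
          huk.symm).resolve_right (hne 0).symm
    · exact Or.inr (Or.inl (tri j y hy e))
    · exact Or.inr (Or.inl (tri j y hy e))

end DIM
end
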